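/- arXiv:1207.2313 — 2 statements merged into one kernel-verified Lean document; each statement's English description precedes it below -/
import Mathlib

section
/- Equip O(Σ_q³(l,−)) with the ℤ-grading determined by deg x = 1, deg y = 1, deg z = −2. Then the degree-zero component of O(Σ_q³(l,−)) equals the *-subalgebra generated by the three elements x²z, xyz and y²z (this subalgebra is the coordinate algebra O(ℝP_q²(l;−)) of the quantum real weighted projective space). -/
/-- The defining relations of `O(Σ_q³(l,−))`: `y* = yz`, `xy = q^l yx`,
`xx* = ∏_{p=0}^{l−1}(1 − q^{2p}y²z)`, `x*x = ∏_{p=1}^{l}(1 − q^{−2p}y²z)`, with `z`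
central (it suffices to commute with the generators and their adjoints) and unitary. -/
structure SMinusRels {A : Type} [Ring A] [Algebra ℂ A] [StarRing A] [StarModule ℂ A]
    (q : ℝ) (l : ℕ) (x y z : A) : Prop where
  central_x : z * x = x * z
  central_y : z * y = y * z
  central_xs : z * star x = star x * z
  central_ys : z * star y = star y * z
  unitary : z * star z = 1
  unitary' : star z * z = 1
  rel_ystar : star y = y * z
  rel_xy : x * y = ((q : ℂ) ^ l) • (y * x)
  rel_xxs : x * star x =
    ((List.range l).map (fun p => 1 - ((q : ℂ) ^ (2 * p)) • (y ^ 2 * z))).prod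
  rel_xsx : star x * x =
    ((List.range l).map (fun p => 1 - (((q : ℂ)⁻¹) ^ (2 * (p + 1))) • (y ^ 2 * z))).prod

/-- A presentation of `O(Σ_q³(l,−))`: the *universal* unital complex *-algebra with
generators `x, y` and a central unitary `z` subject to `SMinusRels`. -/
structure SMinusAlg (q : ℝ) (l : ℕ) where
  A : Type
  [ringA : Ring A]
  [algA : Algebra ℂ A]
  [starA : StarRing A]
  [smodA : StarModule ℂ A]
  x : A
  y : A
  z : A
  rels : SMinusRels q l x y z
  universal : ∀ (B : Type) [Ring B] [Algebra ℂ B] [StarRing B] [StarModule ℂ B]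
      (x' y' z' : B), SMinusRels q l x' y' z' →
      ∃! f : A →⋆ₐ[ℂ] B, f x = x' ∧ f y = y' ∧ f z = z'

attribute [instance] SMinusAlg.ringA SMinusAlg.algA SMinusAlg.starA SMinusAlg.smodA

/-- Submodules contained termwise in an independent family and spanning the whole space
coincide with that family. -/
theorem iSupIndep.le_of_iSup_eq_top {R M ι : Type*} [Ring R] [AddCommGroup M] [Module R M]
    {𝒜 P : ι → Submodule R M} (hind : iSupIndep 𝒜) (hle : ∀ i, P i ≤ 𝒜 i)
    (htop : ⨆ i, P i = ⊤) (i : ι) : 𝒜 i ≤ P i := by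
  have hcover : P i ⊔ ⨆ j ≠ i, 𝒜 j = ⊤ := by
    rw [eq_top_iff, ← htop]
    refine iSup_le fun j => ?_
    by_cases hj : j = i
    · subst hj
      exact le_sup_left
    · exact (hle j).trans ((le_iSup₂ (f := fun j (_ : j ≠ i) => 𝒜 j) j hj).trans le_sup_right)
  have hmod : (P i ⊔ ⨆ j ≠ i, 𝒜 j) ⊓ 𝒜 i = P i ⊔ (⨆ j ≠ i, 𝒜 j) ⊓ 𝒜 i :=
    (sup_inf_assoc_of_le _ (hle i))
  rw [hcover, top_inf_eq, inf_comm, (hind i).eq_bot, sup_bot_eq] at hmod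
  exact hmod.le

namespace SMinusAlg

variable {q : ℝ} {l : ℕ}

/-- The universal algebra is generated, as a *-algebra, by `x`, `y` and `z`. -/
theorem adjoin_generators_eq_top (Pm : SMinusAlg q l) :
    StarAlgebra.adjoin ℂ {Pm.x, Pm.y, Pm.z} = ⊤ := by
  set T := StarAlgebra.adjoin ℂ {Pm.x, Pm.y, Pm.z}
  have hsub := StarAlgebra.subset_adjoin ℂ {Pm.x, Pm.y, Pm.z}
  let x' : T := ⟨Pm.x, hsub (by simp)⟩
  let y' : T := ⟨Pm.y, hsub (by simp)⟩
  let z' : T := ⟨Pm.z, hsub (by simp)⟩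
  have hrels : SMinusRels q l x' y' z' :=
    { central_x := Subtype.ext Pm.rels.central_x
      central_y := Subtype.ext Pm.rels.central_y
      central_xs := Subtype.ext Pm.rels.central_xs
      central_ys := Subtype.ext Pm.rels.central_ys
      unitary := Subtype.ext Pm.rels.unitary
      unitary' := Subtype.ext Pm.rels.unitary'
      rel_ystar := Subtype.ext Pm.rels.rel_ystar
      rel_xy := Subtype.ext Pm.rels.rel_xy
      rel_xxs := by
        apply T.subtype_injective
        rw [map_list_prod, List.map_map]
        exact Pm.rels.rel_xxs
      rel_xsx := by
        apply T.subtype_injective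
        rw [map_list_prod, List.map_map]
        exact Pm.rels.rel_xsx }
  obtain ⟨f, ⟨hfx, hfy, hfz⟩, -⟩ := Pm.universal T x' y' z' hrels
  have hid : T.subtype.comp f = StarAlgHom.id ℂ Pm.A :=
    (Pm.universal Pm.A Pm.x Pm.y Pm.z Pm.rels).unique
      ⟨congrArg Subtype.val hfx, congrArg Subtype.val hfy, congrArg Subtype.val hfz⟩
      ⟨rfl, rfl, rfl⟩
  refine eq_top_iff.2 fun a _ => ?_
  have ha : ((f a : T) : Pm.A) = a := DFunLike.congr_fun hid a
  exact ha ▸ (f a).2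

end SMinusAlg

namespace SMinusRels

variable {A : Type} [Ring A] [Algebra ℂ A] [StarRing A] [StarModule ℂ A]
  {q : ℝ} {l : ℕ} {x y z : A}

/-- The unitary `z` as a unit. -/
def unit (h : SMinusRels q l x y z) : Aˣ := ⟨z, star z, h.unitary, h.unitary'⟩

theorem commute_unit_zpow (h : SMinusRels q l x y z) {a : A} (ha : z * a = a * z) (k : ℤ) :
    Commute a ((h.unit ^ k : Aˣ) : A) :=
  Commute.units_zpow_right (u := h.unit) ha.symm k

theorem star_xyz (h : SMinusRels q l x y z) : star (x * y * z) = y * star x := by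
  rw [star_mul, star_mul, h.rel_ystar, ← h.central_y, mul_assoc z, ← mul_assoc, h.unitary',
    one_mul]

theorem star_x_mul_y (h : SMinusRels q l x y z) :
    y * star x = (q : ℂ) ^ l • (star x * y) := by
  have hs := congrArg star h.rel_xy
  rw [star_mul, star_smul, star_mul, h.rel_ystar] at hs
  have hq : star ((q : ℂ) ^ l) = (q : ℂ) ^ l := by simp
  rw [hq, mul_assoc, h.central_xs, ← mul_assoc, ← mul_assoc, ← smul_mul_assoc] at hs
  simpa [mul_assoc, h.unitary] using congrArg (· * star z) hs

variable (x y z) in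
/-- The coordinate algebra of the quantum real weighted projective space. -/
abbrev projective : StarSubalgebra ℂ A :=
  StarAlgebra.adjoin ℂ {x ^ 2 * z, x * y * z, y ^ 2 * z}

theorem xxz_mem : x * x * z ∈ projective x y z := by
  rw [← sq]; exact StarAlgebra.subset_adjoin ℂ _ (by simp)

theorem xyz_mem : x * y * z ∈ projective x y z :=
  StarAlgebra.subset_adjoin ℂ _ (by simp)

theorem yyz_mem : y ^ 2 * z ∈ projective x y z :=
  StarAlgebra.subset_adjoin ℂ _ (by simp)

theorem yxz_mem (h : SMinusRels q l x y z) (hq : q ≠ 0) :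
    y * x * z ∈ projective x y z := by
  have hc : (q : ℂ) ^ l ≠ 0 := pow_ne_zero _ (by exact_mod_cast hq)
  have := (projective x y z).smul_mem (xyz_mem (x := x) (y := y) (z := z)) ((q : ℂ) ^ l)⁻¹
  rwa [h.rel_xy, smul_mul_assoc, inv_smul_smul₀ hc] at this

theorem y_star_x_mem (h : SMinusRels q l x y z) : y * star x ∈ projective x y z :=
  h.star_xyz ▸ star_mem xyz_mem

theorem star_x_y_mem (h : SMinusRels q l x y z) (hq : q ≠ 0) :
    star x * y ∈ projective x y z := by
  have hc : (q : ℂ) ^ l ≠ 0 := pow_ne_zero _ (by exact_mod_cast hq)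
  have := (projective x y z).smul_mem h.y_star_x_mem ((q : ℂ) ^ l)⁻¹
  rwa [h.star_x_mul_y, inv_smul_smul₀ hc] at this

theorem star_x_star_x_mem (h : SMinusRels q l x y z) :
    star x * star x * star z ∈ projective x y z := by
  have hs : star (x * x * z) = star x * star x * star z := by
    rw [mul_assoc, ← h.central_x, ← mul_assoc, ← h.central_x, mul_assoc, star_mul, star_mul]
  exact hs ▸ star_mem xxz_mem

theorem prod_one_sub_smul_mem (c : ℕ → ℂ) :
    ((List.range l).map fun p => 1 - c p • (y ^ 2 * z)).prod ∈ projective x y z := by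
  refine list_prod_mem fun a ha => ?_
  obtain ⟨p, -, rfl⟩ := List.mem_map.1 ha
  exact sub_mem (one_mem _) ((projective x y z).smul_mem yyz_mem _)

theorem x_star_x_mem (h : SMinusRels q l x y z) : x * star x ∈ projective x y z :=
  h.rel_xxs ▸ prod_one_sub_smul_mem _

theorem star_x_x_mem (h : SMinusRels q l x y z) : star x * x ∈ projective x y z :=
  h.rel_xsx ▸ prod_one_sub_smul_mem _

/-- Elements that, regarded as having degree `n`, are brought into the coordinate algebra by the
appropriate power of `z`, after multiplication by one more generator when `n` is odd. -/
def balanced (h : SMinusRels q l x y z) (n : ℤ) : Submodule ℂ A where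
  carrier := {a | ∀ k : ℤ, (n = 2 * k → a * (h.unit ^ k : Aˣ) ∈ projective x y z) ∧
    (n = 2 * k + 1 → x * a * (h.unit ^ (k + 1) : Aˣ) ∈ projective x y z ∧
      star x * a * (h.unit ^ k : Aˣ) ∈ projective x y z ∧
      y * a * (h.unit ^ (k + 1) : Aˣ) ∈ projective x y z)}
  add_mem' {a b} ha hb k := by
    refine ⟨fun hn => ?_, fun hn => ?_⟩
    · simpa only [add_mul] using add_mem ((ha k).1 hn) ((hb k).1 hn)
    · obtain ⟨a1, a2, a3⟩ := (ha k).2 hn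
      obtain ⟨b1, b2, b3⟩ := (hb k).2 hn
      simp only [mul_add, add_mul]
      exact ⟨add_mem a1 b1, add_mem a2 b2, add_mem a3 b3⟩
  zero_mem' k := by simp
  smul_mem' c a ha k := by
    refine ⟨fun hn => ?_, fun hn => ?_⟩
    · simpa only [smul_mul_assoc] using (projective x y z).smul_mem ((ha k).1 hn) c
    · obtain ⟨a1, a2, a3⟩ := (ha k).2 hn
      simp only [mul_smul_comm, smul_mul_assoc]
      exact ⟨(projective x y z).smul_mem a1 c, (projective x y z).smul_mem a2 c,
        (projective x y z).smul_mem a3 c⟩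

theorem one_mem_balanced (h : SMinusRels q l x y z) : (1 : A) ∈ h.balanced 0 := by
  refine fun k => ⟨fun hk => ?_, fun hk => by omega⟩
  obtain rfl : k = 0 := by omega
  simp

theorem mem_of_mem_balanced_zero (h : SMinusRels q l x y z) {a : A} (ha : a ∈ h.balanced 0) :
    a ∈ projective x y z := by
  simpa using (ha 0).1 rfl

/-- A product `b * a` is brought into the coordinate algebra by `z ^ (i + k)` when `b` is by
`z ^ i` and `a` is by `z ^ k`. -/
theorem mul_mul_zpow_mem (h : SMinusRels q l x y z) {a b : A} {i j k : ℤ}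
    (hb : b * (h.unit ^ i : Aˣ) ∈ projective x y z) (ha : a * (h.unit ^ k : Aˣ) ∈ projective x y z)
    (hcomm : z * a = a * z) (hj : j = i + k) :
    b * a * (h.unit ^ j : Aˣ) ∈ projective x y z := by
  have hmem := mul_mem hb ha
  rwa [mul_assoc, ← mul_assoc _ a, ← (h.commute_unit_zpow hcomm i).eq, mul_assoc a,
    ← Units.val_mul, ← zpow_add, ← hj, ← mul_assoc] at hmem

theorem zpow_mul_mem_balanced (h : SMinusRels q l x y z) {a : A} {n i : ℤ}
    (hcomm : z * a = a * z) (ha : a ∈ h.balanced n) :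
    ((h.unit ^ i : Aˣ) : A) * a ∈ h.balanced (n - 2 * i) := by
  have key (b : A) (j : ℤ) : b * ((h.unit ^ i : Aˣ) * a) * (h.unit ^ j : Aˣ) =
      b * a * (h.unit ^ (i + j) : Aˣ) := by
    rw [← (h.commute_unit_zpow hcomm i).eq, zpow_add, Units.val_mul]
    simp only [mul_assoc]
  refine fun k => ⟨fun hn => ?_, fun hn => ?_⟩
  · have := key 1 k
    rw [one_mul, one_mul] at this
    rw [this]
    exact (ha _).1 (by omega)
  · rw [key, key, key]
    have := (ha (i + k)).2 (by omega)
    rwa [add_assoc] at this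

theorem x_mul_mem_balanced (h : SMinusRels q l x y z) (hq : q ≠ 0) {a : A} {n : ℤ}
    (hcomm : z * a = a * z) (ha : a ∈ h.balanced n) : x * a ∈ h.balanced (n + 1) := by
  refine fun k => ⟨fun hn => ?_, fun hn => ?_⟩
  · simpa using ((ha (k - 1)).2 (by omega)).1
  · have hk := (ha k).1 (by omega)
    simp only [← mul_assoc]
    refine ⟨h.mul_mul_zpow_mem (i := 1) ?_ hk hcomm (add_comm _ _),
      h.mul_mul_zpow_mem (i := 0) ?_ hk hcomm (zero_add _).symm,
      h.mul_mul_zpow_mem (i := 1) ?_ hk hcomm (add_comm _ _)⟩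
    · simpa [unit] using xxz_mem
    · simpa using h.star_x_x_mem
    · simpa [unit] using h.yxz_mem hq

theorem y_mul_mem_balanced (h : SMinusRels q l x y z) (hq : q ≠ 0) {a : A} {n : ℤ}
    (hcomm : z * a = a * z) (ha : a ∈ h.balanced n) : y * a ∈ h.balanced (n + 1) := by
  refine fun k => ⟨fun hn => ?_, fun hn => ?_⟩
  · simpa using ((ha (k - 1)).2 (by omega)).2.2
  · have hk := (ha k).1 (by omega)
    simp only [← mul_assoc]
    refine ⟨h.mul_mul_zpow_mem (i := 1) ?_ hk hcomm (add_comm _ _),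
      h.mul_mul_zpow_mem (i := 0) ?_ hk hcomm (zero_add _).symm,
      h.mul_mul_zpow_mem (i := 1) ?_ hk hcomm (add_comm _ _)⟩
    · simpa [unit] using xyz_mem
    · simpa using h.star_x_y_mem hq
    · simpa [unit, sq] using yyz_mem (x := x) (y := y) (z := z)

theorem star_x_mul_mem_balanced (h : SMinusRels q l x y z) {a : A} {n : ℤ}
    (hcomm : z * a = a * z) (ha : a ∈ h.balanced n) : star x * a ∈ h.balanced (n + -1) := by
  refine fun k => ⟨fun hn => ?_, fun hn => ?_⟩
  · exact ((ha k).2 (by omega)).2.1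
  · have hk := (ha (k + 1)).1 (by omega)
    simp only [← mul_assoc]
    refine ⟨h.mul_mul_zpow_mem (i := 0) ?_ hk hcomm (zero_add _).symm,
      h.mul_mul_zpow_mem (i := -1) ?_ hk hcomm (by ring),
      h.mul_mul_zpow_mem (i := 0) ?_ hk hcomm (zero_add _).symm⟩
    · simpa using h.x_star_x_mem
    · rw [zpow_neg_one]
      exact h.star_x_star_x_mem
    · simpa using h.y_star_x_mem

end SMinusRels

namespace SMinusAlg

variable {q : ℝ} {l : ℕ}

theorem z_mul_comm (Pm : SMinusAlg q l) (a : Pm.A) : Pm.z * a = a * Pm.z := by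
  have ha : a ∈ StarAlgebra.adjoin ℂ {Pm.x, Pm.y, Pm.z} := by
    rw [adjoin_generators_eq_top]; trivial
  have hr := Pm.rels
  have hs : Commute Pm.z (star Pm.z) := hr.unitary.trans hr.unitary'.symm
  have hc : Commute Pm.z a ∧ Commute Pm.z (star a) := by
    induction ha using StarAlgebra.adjoin_induction with
    | mem b hb =>
      rcases hb with rfl | rfl | rfl
      exacts [⟨hr.central_x, hr.central_xs⟩, ⟨hr.central_y, hr.central_ys⟩, ⟨rfl, hs⟩]
    | algebraMap r =>
      rw [← algebraMap_star_comm]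
      exact ⟨Algebra.commute_algebraMap_right r _, Algebra.commute_algebraMap_right _ _⟩
    | add b c _ _ hb hc =>
      rw [star_add]; exact ⟨hb.1.add_right hc.1, hb.2.add_right hc.2⟩
    | mul b c _ _ hb hc =>
      rw [star_mul]; exact ⟨hb.1.mul_right hc.1, hc.2.mul_right hb.2⟩
    | star b _ hb => exact ⟨hb.2, by rw [star_star]; exact hb.1⟩
  exact hc.1

/-- A subspace containing `1` and stable under left multiplication by the generators and their
adjoints is everything. -/
theorem eq_top_of_mul_mem (Pm : SMinusAlg q l) (L : Submodule ℂ Pm.A) (hone : 1 ∈ L)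
    (hx : ∀ a ∈ L, Pm.x * a ∈ L) (hxs : ∀ a ∈ L, star Pm.x * a ∈ L)
    (hy : ∀ a ∈ L, Pm.y * a ∈ L) (hz : ∀ a ∈ L, Pm.z * a ∈ L)
    (hzs : ∀ a ∈ L, star Pm.z * a ∈ L) : L = ⊤ := by
  refine Submodule.eq_top_iff'.2 fun b => ?_
  have hb : b ∈ StarAlgebra.adjoin ℂ {Pm.x, Pm.y, Pm.z} := by
    rw [adjoin_generators_eq_top]; trivial
  have hmul : (∀ a ∈ L, b * a ∈ L) ∧ ∀ a ∈ L, star b * a ∈ L := by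
    induction hb using StarAlgebra.adjoin_induction with
    | mem c hc =>
      rcases hc with rfl | rfl | rfl
      · exact ⟨hx, hxs⟩
      · refine ⟨hy, fun a ha => ?_⟩
        rw [Pm.rels.rel_ystar, mul_assoc]
        exact hy _ (hz _ ha)
      · exact ⟨hz, hzs⟩
    | algebraMap r =>
      rw [← algebraMap_star_comm]
      simp only [← Algebra.smul_def]
      exact ⟨fun a ha => L.smul_mem _ ha, fun a ha => L.smul_mem _ ha⟩
    | add c d _ _ hc hd =>
      simp only [star_add, add_mul]
      exact ⟨fun a ha => L.add_mem (hc.1 a ha) (hd.1 a ha),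
        fun a ha => L.add_mem (hc.2 a ha) (hd.2 a ha)⟩
    | mul c d _ _ hc hd =>
      simp only [star_mul, mul_assoc]
      exact ⟨fun a ha => hc.1 _ (hd.1 a ha), fun a ha => hd.2 _ (hc.2 a ha)⟩
    | star c _ hc => exact ⟨hc.2, by simpa only [star_star] using hc.1⟩
  simpa using hmul.1 1 hone

end SMinusAlg

/-- equip `O(Σ_q³(l,−))` with the ℤ-grading determined by `deg x = 1`,
`deg y = 1`, `deg z = −2` (a *-algebra grading `𝒜` with internal direct sum
decomposition and the stated degrees of the generators).  Then the degree-zero component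
equals the *-subalgebra generated by `x²z`, `xyz` and `y²z` (the coordinate algebra
`O(ℝP_q²(l;−))` of the quantum real weighted projective space). -/
theorem sminus_degree_zero_eq_adjoin (q : ℝ) (hq0 : 0 < q) (hq1 : q < 1)
    (l : ℕ) (hl : 0 < l) (Pm : SMinusAlg q l) (𝒜 : ℤ → Submodule ℂ Pm.A)
    (hone : (1 : Pm.A) ∈ 𝒜 0)
    (hmul : ∀ (m n : ℤ), ∀ a ∈ 𝒜 m, ∀ b ∈ 𝒜 n, a * b ∈ 𝒜 (m + n))
    (hstar : ∀ (n : ℤ), ∀ a ∈ 𝒜 n, star a ∈ 𝒜 (-n))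
    (hdec : DirectSum.IsInternal 𝒜)
    (hx : Pm.x ∈ 𝒜 1) (hy : Pm.y ∈ 𝒜 1) (hz : Pm.z ∈ 𝒜 (-2)) :
    (𝒜 0 : Set Pm.A) =
      (StarAlgebra.adjoin ℂ
        {Pm.x ^ 2 * Pm.z, Pm.x * Pm.y * Pm.z, Pm.y ^ 2 * Pm.z} :
          StarSubalgebra ℂ Pm.A) := by
  have hr := Pm.rels
  refine Set.Subset.antisymm (fun a ha => ?_) (fun a ha => ?_)
  · let P : ℤ → Submodule ℂ Pm.A := fun n => 𝒜 n ⊓ hr.balanced n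
    have hstable (g : Pm.A) (d : ℤ) (hg : g ∈ 𝒜 d)
        (hbal : ∀ n, ∀ a ∈ hr.balanced n, g * a ∈ hr.balanced (n + d)) :
        ∀ a ∈ ⨆ n, P n, g * a ∈ ⨆ n, P n := by
      intro a ha
      induction ha using Submodule.iSup_induction' with
      | mem n a ha =>
        exact Submodule.mem_iSup_of_mem (n + d)
          ⟨add_comm d n ▸ hmul d n g hg a ha.1, hbal n a ha.2⟩
      | zero => simp
      | add a b _ _ ha hb => rw [mul_add]; exact add_mem ha hb
    have htop : ⨆ n, P n = ⊤ := by
      refine Pm.eq_top_of_mul_mem _ (Submodule.mem_iSup_of_mem 0 ⟨hone, hr.one_mem_balanced⟩)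
        (hstable _ 1 hx fun n a => hr.x_mul_mem_balanced hq0.ne' (Pm.z_mul_comm a))
        (hstable _ (-1) (hstar 1 _ hx) fun n a => hr.star_x_mul_mem_balanced (Pm.z_mul_comm a))
        (hstable _ 1 hy fun n a => hr.y_mul_mem_balanced hq0.ne' (Pm.z_mul_comm a))
        (hstable _ (-2) hz fun n a ha => ?_)
        (hstable _ 2 (hstar (-2) _ hz) fun n a ha => ?_)
      · have := hr.zpow_mul_mem_balanced (i := 1) (Pm.z_mul_comm a) ha
        rwa [zpow_one] at this
      · have := hr.zpow_mul_mem_balanced (i := -1) (Pm.z_mul_comm a) ha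
        rw [zpow_neg_one, mul_neg_one, sub_neg_eq_add] at this
        exact this
    exact hr.mem_of_mem_balanced_zero
      (hdec.submodule_iSupIndep.le_of_iSup_eq_top (fun _ => inf_le_left) htop 0 ha).2
  · change a ∈ 𝒜 0
    induction ha using StarAlgebra.adjoin_induction with
    | mem b hb =>
      rcases hb with rfl | rfl | rfl
      · rw [sq]; exact hmul 2 (-2) _ (hmul 1 1 _ hx _ hx) _ hz
      · exact hmul 2 (-2) _ (hmul 1 1 _ hx _ hy) _ hz
      · rw [sq]; exact hmul 2 (-2) _ (hmul 1 1 _ hy _ hy) _ hz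
    | algebraMap r => rw [Algebra.algebraMap_eq_smul_one]; exact (𝒜 0).smul_mem r hone
    | add b c _ _ hb hc => exact add_mem hb hc
    | mul b c _ _ hb hc => exact hmul 0 0 b hb c hc
    | star b _ hb => exact hstar 0 b hb
end

section
/- Equip O(Σ_q³(l,+)) with the ℤ-grading determined by deg x' = 1, deg y' = 1, deg z' = −1. Then the degree-zero component of O(Σ_q³(l,+)) equals the *-subalgebra generated by the two elements x'z' and y'z' (this subalgebra is the coordinate algebra O(ℝP_q²(l;+)) of the quantum real weighted projective space). -/
/-- The defining relations of `O(Σ_q³(l,+))`: `x'y' = q^{2l}y'x'`, `x'y'* = q^{2l}y'*x'`,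
`y'y'* = q⁴y'*y'`, `y'* = y'z'²`, `x'x'* = ∏_{p=0}^{l−1}(1 − q^{2p}y'z')`,
`x'*x' = ∏_{p=1}^{l}(1 − q^{−2p}y'z')`, with `z'` central (it suffices to commute with
the generators and their adjoints) and unitary. -/
structure SPlusRels {A : Type} [Ring A] [Algebra ℂ A] [StarRing A] [StarModule ℂ A]
    (q : ℝ) (l : ℕ) (x y z : A) : Prop where
  central_x : z * x = x * z
  central_y : z * y = y * z
  central_xs : z * star x = star x * z
  central_ys : z * star y = star y * z
  unitary : z * star z = 1
  unitary' : star z * z = 1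
  rel_xy : x * y = ((q : ℂ) ^ (2 * l)) • (y * x)
  rel_xys : x * star y = ((q : ℂ) ^ (2 * l)) • (star y * x)
  rel_yys : y * star y = ((q : ℂ) ^ 4) • (star y * y)
  rel_ystar : star y = y * z ^ 2
  rel_xxs : x * star x =
    ((List.range l).map (fun p => 1 - ((q : ℂ) ^ (2 * p)) • (y * z))).prod
  rel_xsx : star x * x =
    ((List.range l).map (fun p => 1 - (((q : ℂ)⁻¹) ^ (2 * (p + 1))) • (y * z))).prod

/-- A presentation of `O(Σ_q³(l,+))`: the *universal* unital complex *-algebra with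
generators `x', y'` and a central unitary `z'` subject to `SPlusRels`. -/
structure SPlusAlg (q : ℝ) (l : ℕ) where
  A : Type
  [ringA : Ring A]
  [algA : Algebra ℂ A]
  [starA : StarRing A]
  [smodA : StarModule ℂ A]
  x : A
  y : A
  z : A
  rels : SPlusRels q l x y z
  universal : ∀ (B : Type) [Ring B] [Algebra ℂ B] [StarRing B] [StarModule ℂ B]
      (x' y' z' : B), SPlusRels q l x' y' z' →
      ∃! f : A →⋆ₐ[ℂ] B, f x = x' ∧ f y = y' ∧ f z = z'

attribute [instance] SPlusAlg.ringA SPlusAlg.algA SPlusAlg.starA SPlusAlg.smodA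

/-- A family of submodules contained in the components of an internal direct sum and spanning
everything consists of these components. -/
theorem DirectSum.IsInternal.eq_of_le_of_iSup_eq_top {R M ι : Type*} [DecidableEq ι] [Ring R]
    [AddCommGroup M] [Module R M] {𝒜 ℬ : ι → Submodule R M} (h𝒜 : DirectSum.IsInternal 𝒜)
    (hle : ∀ i, ℬ i ≤ 𝒜 i) (htop : ⨆ i, ℬ i = ⊤) (i : ι) : ℬ i = 𝒜 i := by
  obtain ⟨_⟩ : Nonempty (DirectSum.Decomposition 𝒜) := ⟨h𝒜.chooseDecomposition⟩
  refine le_antisymm (hle i) fun a ha => ?_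
  have key : ∀ b : M, ((DirectSum.decompose 𝒜 b i : 𝒜 i) : M) ∈ ℬ i := by
    intro b
    have hb : b ∈ ⨆ i, ℬ i := htop ▸ Submodule.mem_top
    induction hb using Submodule.iSup_induction' with
    | mem j b hb =>
      by_cases hj : j = i
      · subst hj
        rwa [DirectSum.decompose_of_mem_same _ (hle j hb)]
      · rw [DirectSum.decompose_of_mem_ne _ (hle j hb) hj]
        exact (ℬ i).zero_mem
    | zero => simp
    | add b c _ _ ihb ihc => simpa using (ℬ i).add_mem ihb ihc
  simpa [DirectSum.decompose_of_mem_same _ ha] using key a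

section Twist

variable {A : Type*} [Ring A] [StarRing A]

/-- Integral powers of a central unitary are central. -/
theorem zpow_central (u : unitary A) (hu : ∀ a : A, (u : A) * a = a * u) (n : ℤ) (a : A) :
    ((u ^ n : unitary A) : A) * a = a * (u ^ n : unitary A) := by
  have h : Commute (Unitary.toUnits u : A) a := hu a
  simpa [← map_zpow] using (h.units_zpow_left n).eq

variable [Algebra ℂ A] [StarModule ℂ A]

/-- The submodule of all `a` with `a * u ^ n ∈ S`. -/
def twist (S : StarSubalgebra ℂ A) (u : unitary A) (n : ℤ) : Submodule ℂ A :=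
  S.toSubalgebra.toSubmodule.comap (LinearMap.mulRight ℂ ((u ^ n : unitary A) : A))

@[simp]
theorem mem_twist {S : StarSubalgebra ℂ A} {u : unitary A} {n : ℤ} {a : A} :
    a ∈ twist S u n ↔ a * (u ^ n : unitary A) ∈ S := Iff.rfl

/-- If every generator lies in some `twist S u n`, then these submodules span everything
generated by them. -/
theorem mem_iSup_twist_of_mem_adjoin (S : StarSubalgebra ℂ A) (u : unitary A)
    (hu : ∀ (n : ℤ) (a : A), ((u ^ n : unitary A) : A) * a = a * (u ^ n : unitary A))
    {s : Set A} (hs : ∀ b ∈ s, ∃ n, b ∈ twist S u n) {a : A}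
    (ha : a ∈ StarAlgebra.adjoin ℂ s) : a ∈ ⨆ n, twist S u n := by
  induction ha using StarAlgebra.adjoin_induction with
  | mem b hb =>
    obtain ⟨n, hn⟩ := hs b hb
    exact Submodule.mem_iSup_of_mem n hn
  | algebraMap r =>
    exact Submodule.mem_iSup_of_mem 0 (by simp [S.algebraMap_mem r])
  | add b c _ _ ihb ihc => exact add_mem ihb ihc
  | mul b c hb' hc' ihb ihc =>
    clear hb' hc'
    induction ihb using Submodule.iSup_induction' with
    | zero => simp
    | add b b' _ _ h h' => rw [add_mul]; exact add_mem h h'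
    | mem m b hb =>
      induction ihc using Submodule.iSup_induction' with
      | zero => simp
      | add c c' _ _ h h' => rw [mul_add]; exact add_mem h h'
      | mem n c hc =>
        refine Submodule.mem_iSup_of_mem (m + n) ?_
        have h := S.mul_mem hb hc
        simp only [LinearMap.mulRight_apply] at h
        rw [mem_twist, zpow_add, Submonoid.coe_mul, mul_assoc, ← mul_assoc c, ← hu m,
          mul_assoc, ← mul_assoc b]
        exact h
  | star b hb' ihb =>
    clear hb'
    induction ihb using Submodule.iSup_induction' with
    | zero => simp
    | add b b' _ _ h h' => rw [star_add]; exact add_mem h h'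
    | mem m b hb =>
      refine Submodule.mem_iSup_of_mem (-m) ?_
      have h : star (b * ((u ^ m : unitary A) : A)) ∈ S := star_mem (mem_twist.mp hb)
      rw [star_mul, ← Unitary.coe_star, Unitary.star_eq_inv, ← zpow_neg, hu] at h
      exact h

end Twist

/-- The universal algebra is generated by `x`, `y` and `z`. -/
theorem SPlusAlg.adjoin_eq_top {q : ℝ} {l : ℕ} (P : SPlusAlg q l) :
    StarAlgebra.adjoin ℂ {P.x, P.y, P.z} = ⊤ := by
  set T : StarSubalgebra ℂ P.A := StarAlgebra.adjoin ℂ {P.x, P.y, P.z}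
  have hsub : {P.x, P.y, P.z} ⊆ (T : Set P.A) := StarAlgebra.subset_adjoin ℂ _
  let x : T := ⟨P.x, hsub (by simp)⟩
  let y : T := ⟨P.y, hsub (by simp)⟩
  let z : T := ⟨P.z, hsub (by simp)⟩
  have hrels : SPlusRels q l x y z := by
    have h := P.rels
    constructor <;> apply T.subtype_injective
    · exact h.central_x
    · exact h.central_y
    · exact h.central_xs
    · exact h.central_ys
    · exact h.unitary
    · exact h.unitary'
    · exact h.rel_xy
    · exact h.rel_xys
    · exact h.rel_yys
    · exact h.rel_ystar
    · rw [map_list_prod, List.map_map]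
      exact h.rel_xxs
    · rw [map_list_prod, List.map_map]
      exact h.rel_xsx
  obtain ⟨f, ⟨hfx, hfy, hfz⟩, -⟩ := P.universal T x y z hrels
  have hid : T.subtype.comp f = StarAlgHom.id ℂ P.A :=
    (P.universal P.A P.x P.y P.z P.rels).unique
      ⟨by simp [hfx, x], by simp [hfy, y], by simp [hfz, z]⟩ ⟨rfl, rfl, rfl⟩
  refine eq_top_iff.mpr fun a _ => ?_
  rw [← show ((f a : T) : P.A) = a from DFunLike.congr_fun hid a]
  exact (f a).2

/-- The generator `z` is central. -/
theorem SPlusAlg.central {q : ℝ} {l : ℕ} (P : SPlusAlg q l) (a : P.A) :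
    P.z * a = a * P.z := by
  have hmem : a ∈ StarAlgebra.adjoin ℂ {P.x, P.y, P.z} :=
    P.adjoin_eq_top ▸ StarSubalgebra.mem_top
  have h : a ∈ StarSubalgebra.centralizer ℂ {P.z} := by
    refine StarAlgebra.adjoin_le ?_ hmem
    rintro b hb
    rw [SetLike.mem_coe, StarSubalgebra.mem_centralizer_iff]
    rintro c rfl
    have key : ∀ b : P.A, P.z * b = b * P.z → P.z * star b = star b * P.z →
        P.z * b = b * P.z ∧ star P.z * b = b * star P.z := fun b h h' =>
      ⟨h, by simpa using (congrArg star h').symm⟩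
    rcases hb with rfl | rfl | rfl
    · exact key _ P.rels.central_x P.rels.central_xs
    · exact key _ P.rels.central_y P.rels.central_ys
    · exact key _ rfl (P.rels.unitary.trans P.rels.unitary'.symm)
  exact (StarSubalgebra.mem_centralizer_iff ℂ |>.mp h _ rfl).1

/-- equip `O(Σ_q³(l,+))` with the ℤ-grading determined by `deg x' = 1`,
`deg y' = 1`, `deg z' = −1` (a *-algebra grading `𝒜` with internal direct sum
decomposition and the stated degrees of the generators).  Then the degree-zero component
equals the *-subalgebra generated by `x'z'` and `y'z'` (the coordinate algebra
`O(ℝP_q²(l;+))` of the quantum real weighted projective space). -/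
theorem splus_degree_zero_eq_adjoin (q : ℝ) (hq0 : 0 < q) (hq1 : q < 1)
    (l : ℕ) (hl : 0 < l) (hlodd : Odd l) (Pp : SPlusAlg q l)
    (𝒜 : ℤ → Submodule ℂ Pp.A)
    (hone : (1 : Pp.A) ∈ 𝒜 0)
    (hmul : ∀ (m n : ℤ), ∀ a ∈ 𝒜 m, ∀ b ∈ 𝒜 n, a * b ∈ 𝒜 (m + n))
    (hstar : ∀ (n : ℤ), ∀ a ∈ 𝒜 n, star a ∈ 𝒜 (-n))
    (hdec : DirectSum.IsInternal 𝒜)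
    (hx : Pp.x ∈ 𝒜 1) (hy : Pp.y ∈ 𝒜 1) (hz : Pp.z ∈ 𝒜 (-1)) :
    (𝒜 0 : Set Pp.A) =
      (StarAlgebra.adjoin ℂ {Pp.x * Pp.z, Pp.y * Pp.z} : StarSubalgebra ℂ Pp.A) := by
  set S : StarSubalgebra ℂ Pp.A := StarAlgebra.adjoin ℂ {Pp.x * Pp.z, Pp.y * Pp.z}
  have hsub : {Pp.x * Pp.z, Pp.y * Pp.z} ⊆ (S : Set Pp.A) := StarAlgebra.subset_adjoin ℂ _
  have hSx : Pp.x * Pp.z ∈ S := hsub (by simp)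
  have hSy : Pp.y * Pp.z ∈ S := hsub (by simp)
  let u : unitary Pp.A := ⟨Pp.z, Unitary.mem_iff.mpr ⟨Pp.rels.unitary', Pp.rels.unitary⟩⟩
  have hudeg : ∀ n : ℤ, ((u ^ (-n) : unitary Pp.A) : Pp.A) ∈ 𝒜 n := by
    have hzs : star Pp.z ∈ 𝒜 1 := by simpa using hstar _ _ hz
    intro n
    induction n with
    | zero => simpa using hone
    | succ n ih =>
      rw [neg_add, zpow_add, zpow_neg_one]
      exact hmul _ _ _ ih _ hzs
    | pred n ih =>
      rw [neg_sub, sub_neg_eq_add, add_comm, zpow_add, zpow_one]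
      rw [neg_neg] at ih
      exact hmul _ _ _ ih _ hz
  have hSdeg : ∀ a ∈ S, a ∈ 𝒜 0 := by
    intro a ha
    induction ha using StarAlgebra.adjoin_induction with
    | mem a ha =>
      rcases ha with rfl | rfl
      · simpa using hmul _ _ _ hx _ hz
      · simpa using hmul _ _ _ hy _ hz
    | algebraMap r =>
      rw [Algebra.algebraMap_eq_smul_one]
      exact (𝒜 0).smul_mem r hone
    | add a b _ _ iha ihb => exact (𝒜 0).add_mem iha ihb
    | mul a b _ _ iha ihb => simpa using hmul _ _ _ iha _ ihb
    | star a _ iha => simpa using hstar _ _ iha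
  have hsup : ∀ a : Pp.A, a ∈ ⨆ n, twist S u n := by
    intro a
    have ha : a ∈ StarAlgebra.adjoin ℂ {Pp.x, Pp.y, Pp.z} :=
      Pp.adjoin_eq_top ▸ StarSubalgebra.mem_top
    refine mem_iSup_twist_of_mem_adjoin S u (zpow_central u Pp.central) ?_ ha
    rintro b (rfl | rfl | rfl)
    · exact ⟨1, by simpa [u] using hSx⟩
    · exact ⟨1, by simpa [u] using hSy⟩
    · refine ⟨-1, ?_⟩
      rw [mem_twist, zpow_neg_one, ← Unitary.star_eq_inv, Unitary.coe_star, Pp.rels.unitary]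
      exact S.one_mem
  have hle : ∀ n, twist S u n ≤ 𝒜 n := by
    intro n a ha
    have h := hmul _ _ _ (hSdeg _ (mem_twist.mp ha)) _ (hudeg n)
    have hu1 : ((u ^ n : unitary Pp.A) : Pp.A) * (u ^ (-n) : unitary Pp.A) = 1 := by
      rw [zpow_neg, ← Submonoid.coe_mul, mul_inv_cancel, Submonoid.coe_one]
    rwa [zero_add, mul_assoc, hu1, mul_one] at h
  have h0 : twist S u 0 = 𝒜 0 :=
    hdec.eq_of_le_of_iSup_eq_top hle (eq_top_iff.mpr fun a _ => hsup a) 0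
  ext a
  rw [← h0]
  simp
end
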